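/- arXiv:math/0011168 — 2 statements merged into one kernel-verified Lean document; each statement's English description precedes it below -/
import Mathlib

section
/- For six points l_1,...,l_6 in generic position in P²(F), represented by lifted vectors in V_3, one has D(r_3(l_1,...,l_6)) = −(1/18)·Alt_6( ⟨l_1,l_2,l_3;l_4,l_5,l_6⟩_2 ⊗ Δ(l_1,l_2,l_3) ) in (B_2(F) ⊗ F*) ⊗ ℚ, where D is the map induced by {x} ↦ {x}_2 ⊗ x and Alt_6 denotes the alternating sum over the symmetric group permuting (l_1,...,l_6). -/
/-!
Statement 4 (Lemma 3.1 of Goncharov, "Geometry of the trilogarithm and the motivic Lie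
algebra of a field"):

For six points `l_1,...,l_6` in generic position in `P²(F)`, one has
`D(r_3(l_1,...,l_6)) = -(1/18)·Alt_6( ⟨l_1,l_2,l_3;l_4,l_5,l_6⟩_2 ⊗ Δ(l_1,l_2,l_3) )`
in `(B_2(F) ⊗ F^*) ⊗ ℚ`, where `D` is induced by `{x} ↦ {x}_2 ⊗ x`.
-/

noncomputable section
open scoped TensorProduct
open Classical

namespace Gon

variable (F : Type) [Field F]

/-- Points of the projective space `P^{d-1}(F)`, i.e. lines in `F^d`. -/
abbrev Pt (d : ℕ) := Projectivization F (Fin d → F)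

variable {F}

/-- Determinant of a `d`-tuple of vectors in `F^d` (w.r.t. the standard volume form). -/
def dt {d : ℕ} (v : Fin d → (Fin d → F)) : F := Matrix.det (Matrix.of v)

/-- `Δ` of three vectors of `F^3`. -/
def det3 (a b c : Fin 3 → F) : F := dt ![a, b, c]

/-- Cross-ratio of four points on the projective line. -/
def cr1 (a b c d : Pt F 2) : F :=
  (dt ![a.rep, c.rep] * dt ![b.rep, d.rep]) / (dt ![a.rep, d.rep] * dt ![b.rep, c.rep])

/-- Cross-ratio of the four points of `P^1` obtained by projecting `a b c d` from the
centre `e` in the projective plane. -/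
def crFrom3 (e a b c d : Pt F 3) : F :=
  (det3 e.rep a.rep c.rep * det3 e.rep b.rep d.rep) /
    (det3 e.rep a.rep d.rep * det3 e.rep b.rep c.rep)

variable (F)

/-- `ℚ[F]`, the free `ℚ`-vector space on the set `F`. -/
abbrev QF := F →₀ ℚ

variable {F}

/-- The generator `{x}` of `ℚ[F]`, with the convention `{0} = {∞} = 0`. -/
def gen (a : F) : QF F := if a = 0 then 0 else Finsupp.single a 1

/-- The five term element of `ℚ[F]` attached to five points of the projective line. -/
def fiveTerm (x : Fin 5 → Pt F 2) : QF F :=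
  ∑ i : Fin 5, ((-1 : ℤ) ^ (i : ℕ)) •
    gen (cr1 (x (i.succAbove 0)) (x (i.succAbove 1)) (x (i.succAbove 2)) (x (i.succAbove 3)))

variable (F)

/-- The subgroup `R_2(F)` of relations: the five-term relations for distinct points of
`P^1(F)`, together with `{1}` (the generators of `ℤ[F^* ∖ {1}]` omit `1`). -/
def R2 : Submodule ℚ (QF F) :=
  Submodule.span ℚ
    ({z | ∃ x : Fin 5 → Pt F 2, Function.Injective x ∧ z = fiveTerm x} ∪ {gen (1 : F)})

/-- The Bloch group `B_2(F)` (tensored with `ℚ`). -/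
abbrev B2 := QF F ⧸ R2 F

def clsB2 : QF F →ₗ[ℚ] B2 F := (R2 F).mkQ

/-- `F^* ⊗ ℚ`, presented as the free `ℚ`-vector space on `F` modulo multiplicativity
(and modulo the generator at `0`). -/
def FSrel : Set (QF F) :=
  {z | ∃ x y : F, x ≠ 0 ∧ y ≠ 0 ∧
      z = Finsupp.single (x * y) 1 - Finsupp.single x 1 - Finsupp.single y 1} ∪
    {Finsupp.single (0 : F) 1}

abbrev FS := QF F ⧸ Submodule.span ℚ (FSrel F)

/-- The class of `x ∈ F` in `F^* ⊗ ℚ`. -/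
def fs (a : F) : FS F := (Submodule.span ℚ (FSrel F)).mkQ (Finsupp.single a 1)

/-- `(B_2(F) ⊗ F^*) ⊗ ℚ`. -/
abbrev T21 := B2 F ⊗[ℚ] FS F

/-- The map `D : ℚ[F] → B_2(F) ⊗ F^*` induced by `{x} ↦ {x}_2 ⊗ x`. -/
def Dmap : QF F →ₗ[ℚ] T21 F :=
  Finsupp.lift (T21 F) ℚ F (fun a => clsB2 F (gen a) ⊗ₜ fs F a)

/-- triple ratio of six points of the plane. -/
def tripleRatio (x : Fin 6 → Pt F 3) : F :=
  (det3 (x 0).rep (x 1).rep (x 3).rep * det3 (x 1).rep (x 2).rep (x 4).rep *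
      det3 (x 2).rep (x 0).rep (x 5).rep) /
    (det3 (x 0).rep (x 1).rep (x 4).rep * det3 (x 1).rep (x 2).rep (x 5).rep *
      det3 (x 2).rep (x 0).rep (x 3).rep)

variable {F}

/-- The generalized cross-ratio `r_3` of six points of `P^2`, as an element of `ℚ[F]`:
`r_3(x_1,...,x_6) = (1/15)·Alt_6 {triple ratio}`. -/
def r3free (x : Fin 6 → Pt F 3) : QF F :=
  (1 / 15 : ℚ) • ∑ σ : Equiv.Perm (Fin 6), (Equiv.Perm.sign σ : ℤ) • gen (tripleRatio F (x ∘ σ))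

/-- Six points of `P^2` are in generic position: no two coincide and no three are collinear. -/
def Generic6 (x : Fin 6 → Pt F 3) : Prop :=
  ∀ a b c : Fin 6, a ≠ b → a ≠ c → b ≠ c → det3 (x a).rep (x b).rep (x c).rep ≠ 0

/-- `⟨l_0,l_1,l_2;m_0,m_1,m_2⟩_2` for `3+3` points of the plane, at the level of `ℚ[F]`:
`Σ_{i,j} (-1)^{i+j} {r(l_i | l_0,...,l̂_i,...,l_2; m_0,...,m̂_j,...,m_2)}`. -/
def a2free (x y : Fin 3 → Pt F 3) : QF F :=
  ∑ i : Fin 3, ∑ j : Fin 3, ((-1 : ℤ) ^ ((i : ℕ) + (j : ℕ))) •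
    gen (crFrom3 (x i) (x (i.succAbove 0)) (x (i.succAbove 1))
      (y (j.succAbove 0)) (y (j.succAbove 1)))

/-! ### The dilogarithm class of an element of the field -/

/-- The class of `{a}` in `B_2(F)`. -/
def dilog (a : F) : B2 F := clsB2 F (gen a)

lemma dilog_zero : dilog (0 : F) = 0 := by simp [dilog, gen]

lemma dilog_one : dilog (1 : F) = 0 :=
  (Submodule.Quotient.mk_eq_zero _).2 (Submodule.subset_span (Or.inr rfl))

lemma dt_two (a b : Fin 2 → F) : dt ![a, b] = a 0 * b 1 - a 1 * b 0 := by
  simp [dt, Matrix.det_fin_two]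

lemma dt_smul_smul (r s : F) (a b : Fin 2 → F) :
    dt ![r • a, s • b] = r * s * dt ![a, b] := by
  simp only [dt_two, Pi.smul_apply, smul_eq_mul]; ring

lemma cr1_mk {a b c d : Fin 2 → F} (ha : a ≠ 0) (hb : b ≠ 0) (hc : c ≠ 0) (hd : d ≠ 0) :
    cr1 (.mk F a ha) (.mk F b hb) (.mk F c hc) (.mk F d hd) =
      (dt ![a, c] * dt ![b, d]) / (dt ![a, d] * dt ![b, c]) := by
  obtain ⟨p, hp⟩ := Projectivization.exists_smul_eq_mk_rep F a ha
  obtain ⟨q, hq⟩ := Projectivization.exists_smul_eq_mk_rep F b hb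
  obtain ⟨r, hr⟩ := Projectivization.exists_smul_eq_mk_rep F c hc
  obtain ⟨s, hs⟩ := Projectivization.exists_smul_eq_mk_rep F d hd
  have h : (p * q * r * s : F) ≠ 0 := by simp
  rw [cr1, ← hp, ← hq, ← hr, ← hs]
  simp only [Units.smul_def, dt_smul_smul]
  rw [← mul_div_mul_left (dt ![a, c] * dt ![b, d]) _ h]
  congr 1 <;> ring

/-- The five-term relation in Suslin's form. -/
lemma dilog_five_term_of_ne {x y : F} (hx0 : x ≠ 0) (hx1 : x ≠ 1) (hy0 : y ≠ 0) (hy1 : y ≠ 1)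
    (hxy : x ≠ y) :
    dilog (x * (1 - y) / (y * (1 - x))) - dilog ((1 - y) / (1 - x)) + dilog (y / x) - dilog y
      + dilog x = 0 := by
  let v : Fin 5 → Fin 2 → F := ![![1, 0], ![0, 1], ![1, 1], ![x, 1], ![y, 1]]
  have hv : ∀ i, v i ≠ 0 := by
    intro i h
    have h0 := congrFun h 0
    have h1 := congrFun h 1
    fin_cases i <;> simp [v] at h0 h1
  have hdt : ∀ i j, i ≠ j → dt ![v i, v j] ≠ 0 := by
    intro i j hij
    fin_cases i <;> fin_cases j <;>
      simp [v, dt_two, sub_eq_zero, hx0, hx1, hy0, hy1, hxy, hx1.symm, hy1.symm, hxy.symm] at hij ⊢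
  have hinj : Function.Injective fun i => Projectivization.mk F (v i) (hv i) := by
    intro i j hij
    by_contra hne
    obtain ⟨a, ha⟩ := (Projectivization.mk_eq_mk_iff F _ _ (hv i) (hv j)).1 hij
    apply hdt i j hne
    rw [← ha, dt_two, Units.smul_def]
    simp only [Pi.smul_apply, smul_eq_mul]
    ring
  have hx1' : 1 - x ≠ 0 := sub_ne_zero.2 hx1.symm
  have key : clsB2 F (fiveTerm fun i => Projectivization.mk F (v i) (hv i)) = 0 :=
    (Submodule.Quotient.mk_eq_zero _).2 (Submodule.subset_span (Or.inl ⟨_, hinj, rfl⟩))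
  simp only [fiveTerm, Fin.sum_univ_five, cr1_mk, map_add, map_zsmul] at key
  simp [v, dt_two, Fin.succAbove, ← Fin.val_fin_lt] at key
  simp only [dilog]
  rw [← key]
  module

/-- The five-term relation, including its degenerate cases. -/
lemma dilog_five_term {x y p q w : F} (hx : x ≠ 0) (hy : y ≠ 0) (hp0 : p ≠ 0)
    (hp : p * (1 - x) = 1 - y) (hq : q * y = x * p) (hw : w * x = y) :
    dilog q - dilog p + dilog w - dilog y + dilog x = 0 := by
  obtain rfl | hx1 := eq_or_ne x 1
  · obtain rfl : y = 1 := by linear_combination hp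
    obtain rfl : q = p := by linear_combination hq
    obtain rfl : w = 1 := by linear_combination hw
    simp [dilog_one]
  have hx1' : 1 - x ≠ 0 := sub_ne_zero.2 hx1.symm
  obtain rfl : p = (1 - y) / (1 - x) := by rw [← hp]; field_simp
  obtain rfl : w = y / x := by rw [← hw]; field_simp
  obtain rfl : q = x * (1 - y) / (y * (1 - x)) := by
    field_simp at hq ⊢
    linear_combination hq
  obtain rfl | hy1 := eq_or_ne y 1
  · simp at hp0
  obtain rfl | hxy := eq_or_ne x y
  · simp [dilog_one, hx, hx1']
  exact dilog_five_term_of_ne hx hx1 hy hy1 hxy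

/-- Inversion acts by `-1` on `B_2(F)`, as soon as `F` has at least four elements. -/
lemma dilog_inv (hF : ∀ z : F, ∃ y, y ≠ 0 ∧ y ≠ 1 ∧ y ≠ z) (z : F) :
    dilog z⁻¹ = -dilog z := by
  obtain rfl | hz0 := eq_or_ne z 0
  · simp [dilog_zero]
  obtain rfl | hz1 := eq_or_ne z 1
  · simp [dilog_one]
  let f : F → B2 F := fun a => dilog a + dilog a⁻¹
  have hf : ∀ a, f a⁻¹ = f a := fun a => by simp only [f, inv_inv, add_comm]
  have hfun : ∀ x y : F, x ≠ 0 → x ≠ 1 → y ≠ 0 → y ≠ 1 → x ≠ y → f (y / x) = f y - f x := by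
    intro x y hx0 hx1 hy0 hy1 hxy
    have hx1' : 1 - x ≠ 0 := sub_ne_zero.2 hx1.symm
    have hy1' : 1 - y ≠ 0 := sub_ne_zero.2 hy1.symm
    have h1 := dilog_five_term (x := x) (y := y) (p := (1 - y) / (1 - x))
      (q := x * (1 - y) / (y * (1 - x))) (w := y / x) hx0 hy0 (div_ne_zero hy1' hx1')
      (by field_simp) (by field_simp) (by field_simp)
    have h2 := dilog_five_term (x := x⁻¹) (y := y⁻¹) (p := x * (1 - y) / (y * (1 - x)))
      (q := (1 - y) / (1 - x)) (w := (y / x)⁻¹) (inv_ne_zero hx0) (inv_ne_zero hy0)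
      (div_ne_zero (mul_ne_zero hx0 hy1') (mul_ne_zero hy0 hx1'))
      (by field_simp; ring) (by field_simp) (by field_simp)
    simp only [f]
    rw [← sub_eq_zero, ← add_zero (0 : B2 F)]
    nth_rewrite 1 [← h1]
    rw [← h2]
    module
  obtain ⟨x, hx0, hx1, hxz⟩ := hF z⁻¹
  have hzx0 : z * x ≠ 0 := mul_ne_zero hz0 hx0
  have hzx1 : z * x ≠ 1 := fun h => hxz (eq_inv_of_mul_eq_one_right h)
  have hne : x ≠ z * x := fun h => hz1 (mul_right_cancel₀ hx0 (by rw [← h, one_mul]))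
  have h1 := hfun x (z * x) hx0 hx1 hzx0 hzx1 hne
  have h2 := hfun (z * x) x hzx0 hzx1 hx0 hx1 hne.symm
  rw [mul_div_cancel_right₀ _ hx0] at h1
  rw [← inv_div, mul_div_cancel_right₀ _ hx0, hf] at h2
  have h3 : (2 : ℚ) • f z = 0 := by
    rw [two_smul]
    nth_rewrite 1 [h1]
    rw [h2]
    abel
  have h4 : dilog z + dilog z⁻¹ = 0 := (smul_eq_zero.1 h3).resolve_left two_ne_zero
  exact eq_neg_of_add_eq_zero_right h4

/-! ### The class of an element of the field in `F^* ⊗ ℚ` -/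

lemma fs_mul {a b : F} (ha : a ≠ 0) (hb : b ≠ 0) : fs F (a * b) = fs F a + fs F b := by
  have h : (Submodule.span ℚ (FSrel F)).mkQ
      (Finsupp.single (a * b) 1 - Finsupp.single a 1 - Finsupp.single b 1) = 0 :=
    (Submodule.Quotient.mk_eq_zero _).2 (Submodule.subset_span (Or.inl ⟨a, b, ha, hb, rfl⟩))
  rw [map_sub, map_sub, sub_sub, sub_eq_zero] at h
  exact h

lemma fs_one : fs F (1 : F) = 0 := by
  simpa using fs_mul (one_ne_zero (α := F)) one_ne_zero

lemma fs_neg (a : F) : fs F (-a) = fs F a := by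
  obtain rfl | ha := eq_or_ne a 0
  · rw [neg_zero]
  have h := fs_mul (a := (-1 : F)) (b := -1) (by simp) (by simp)
  rw [neg_mul_neg, one_mul, fs_one, ← two_smul ℚ] at h
  have h' : fs F (-1 : F) = 0 := (smul_eq_zero.1 h.symm).resolve_left two_ne_zero
  rw [← neg_one_mul, fs_mul (by simp) ha, h', zero_add]

lemma fs_div {a b : F} (ha : a ≠ 0) (hb : b ≠ 0) : fs F (a / b) = fs F a - fs F b := by
  rw [eq_sub_iff_add_eq, ← fs_mul (div_ne_zero ha hb) hb, div_mul_cancel₀ _ hb]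

lemma fs_triple_div {a b c d e f : F} (ha : a ≠ 0) (hb : b ≠ 0) (hc : c ≠ 0) (hd : d ≠ 0)
    (he : e ≠ 0) (hf : f ≠ 0) :
    fs F (a * b * c / (d * e * f)) = fs F a + fs F b + fs F c - fs F d - fs F e - fs F f := by
  rw [fs_div (by simp [*]) (by simp [*]), fs_mul (mul_ne_zero ha hb) hc, fs_mul ha hb,
    fs_mul (mul_ne_zero hd he) hf, fs_mul hd he]
  abel

/-! ### Determinants of triples of vectors -/

lemma det3_eq (a b c : Fin 3 → F) :
    det3 a b c = a 0 * b 1 * c 2 - a 0 * b 2 * c 1 - a 1 * b 0 * c 2 + a 1 * b 2 * c 0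
      + a 2 * b 0 * c 1 - a 2 * b 1 * c 0 := by
  simp [det3, dt, Matrix.det_fin_three]

lemma det3_swap_left (a b c : Fin 3 → F) : det3 b a c = -det3 a b c := by
  simp only [det3_eq]; ring

lemma det3_swap_right (a b c : Fin 3 → F) : det3 a c b = -det3 a b c := by
  simp only [det3_eq]; ring

lemma det3_rotate (a b c : Fin 3 → F) : det3 b c a = det3 a b c := by
  simp only [det3_eq]; ring

lemma det3_pluecker (e a b c d : Fin 3 → F) :
    det3 e a c * det3 e b d - det3 e a d * det3 e b c = det3 e a b * det3 e c d := by
  simp only [det3_eq]; ring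

/-- The difference between the two terms of a triple ratio is a determinant times an expression
depending only on the lines `ad`, `be`, `cf`. -/
lemma det3_triple_ratio (a b c d e f : Fin 3 → F) :
    det3 a b d * det3 b c e * det3 c a f - det3 a b e * det3 b c f * det3 c a d =
      det3 a b c * (det3 a d b * det3 e c f - det3 a d e * det3 b c f) := by
  simp only [det3_eq]; ring

/-! ### Relations between dilogarithms of points of the plane -/

lemma Generic6.comp {x : Fin 6 → Pt F 3} (hx : Generic6 x) (σ : Equiv.Perm (Fin 6)) :
    Generic6 (x ∘ σ) := fun _ _ _ hab hac hbc =>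
  hx _ _ _ (σ.injective.ne hab) (σ.injective.ne hac) (σ.injective.ne hbc)

/-- A field over which six points of the plane can be in generic position has at least four
elements. -/
lemma Generic6.exists_ne {x : Fin 6 → Pt F 3} (hx : Generic6 x) (z : F) :
    ∃ y, y ≠ 0 ∧ y ≠ 1 ∧ y ≠ z := by
  have h (i j : Fin 6) (h0i : 0 ≠ i) (h0j : 0 ≠ j) (hij : i ≠ j) :
      det3 (x 0).rep (x i).rep (x j).rep ≠ 0 := hx 0 i j h0i h0j hij
  have h12 := h 1 2 (by decide) (by decide) (by decide)
  have h13 := h 1 3 (by decide) (by decide) (by decide)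
  have h14 := h 1 4 (by decide) (by decide) (by decide)
  have h15 := h 1 5 (by decide) (by decide) (by decide)
  have h23 := h 2 3 (by decide) (by decide) (by decide)
  have h24 := h 2 4 (by decide) (by decide) (by decide)
  have h25 := h 2 5 (by decide) (by decide) (by decide)
  have h34 := h 3 4 (by decide) (by decide) (by decide)
  have h35 := h 3 5 (by decide) (by decide) (by decide)
  have h45 := h 4 5 (by decide) (by decide) (by decide)
  have pl (b c d : Fin 6) := det3_pluecker (x 0).rep (x 1).rep (x b).rep (x c).rep (x d).rep
  have h0 (c d : Fin 6) (h1c : det3 (x 0).rep (x 1).rep (x c).rep ≠ 0)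
      (h2d : det3 (x 0).rep (x 2).rep (x d).rep ≠ 0)
      (h1d : det3 (x 0).rep (x 1).rep (x d).rep ≠ 0)
      (h2c : det3 (x 0).rep (x 2).rep (x c).rep ≠ 0)
      (hcd : det3 (x 0).rep (x c).rep (x d).rep ≠ 0) :
      crFrom3 (x 0) (x 1) (x 2) (x c) (x d) ≠ 0 ∧
        crFrom3 (x 0) (x 1) (x 2) (x c) (x d) ≠ 1 := by
    refine ⟨div_ne_zero (mul_ne_zero h1c h2d) (mul_ne_zero h1d h2c), fun hc => ?_⟩
    rw [crFrom3, div_eq_one_iff_eq (mul_ne_zero h1d h2c)] at hc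
    have := pl 2 c d
    rw [hc, sub_self] at this
    exact mul_ne_zero h12 hcd this.symm
  have hne : crFrom3 (x 0) (x 1) (x 2) (x 3) (x 4) ≠ crFrom3 (x 0) (x 1) (x 2) (x 3) (x 5) := by
    intro hc
    rw [crFrom3, crFrom3, div_eq_div_iff (mul_ne_zero h14 h23) (mul_ne_zero h15 h23)] at hc
    have hc' : det3 (x 0).rep (x 1).rep (x 4).rep * det3 (x 0).rep (x 2).rep (x 5).rep
        - det3 (x 0).rep (x 1).rep (x 5).rep * det3 (x 0).rep (x 2).rep (x 4).rep = 0 := by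
      refine (mul_eq_zero.1 ?_).resolve_left (mul_ne_zero h13 h23)
      linear_combination -hc
    rw [pl 2 4 5] at hc'
    exact mul_ne_zero h12 h45 hc'
  have hA := h0 3 4 h13 h24 h14 h23 h34
  have hB := h0 3 5 h13 h25 h15 h23 h35
  by_cases hz : crFrom3 (x 0) (x 1) (x 2) (x 3) (x 4) = z
  · exact ⟨_, hB.1, hB.2, fun h => hne (hz.trans h.symm)⟩
  · exact ⟨_, hA.1, hA.2, hz⟩

/-- The dilogarithm of the cross-ratio of the points `p a, p b, p c, p d` seen from `p e`. -/
def crDilog (e a b c d : Fin 6) (p : Fin 6 → Pt F 3) : B2 F :=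
  dilog (crFrom3 (p e) (p a) (p b) (p c) (p d))

/-- The five-term relation for the projections from `p 1` of the other five points. -/
lemma crDilog_five_term {p : Fin 6 → Pt F 3} (hp : Generic6 p) :
    crDilog 1 2 3 4 5 p - crDilog 1 0 3 4 5 p + crDilog 1 0 2 4 5 p - crDilog 1 0 2 3 5 p
      + crDilog 1 0 2 3 4 p = 0 := by
  have h (i j : Fin 6) (h1i : 1 ≠ i) (h1j : 1 ≠ j) (hij : i ≠ j) :
      det3 (p 1).rep (p i).rep (p j).rep ≠ 0 := hp 1 i j h1i h1j hij
  have h02 := h 0 2 (by decide) (by decide) (by decide)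
  have h03 := h 0 3 (by decide) (by decide) (by decide)
  have h04 := h 0 4 (by decide) (by decide) (by decide)
  have h05 := h 0 5 (by decide) (by decide) (by decide)
  have h23 := h 2 3 (by decide) (by decide) (by decide)
  have h24 := h 2 4 (by decide) (by decide) (by decide)
  have h25 := h 2 5 (by decide) (by decide) (by decide)
  have h34 := h 3 4 (by decide) (by decide) (by decide)
  have h35 := h 3 5 (by decide) (by decide) (by decide)
  have h45 := h 4 5 (by decide) (by decide) (by decide)
  have pl (d : Fin 6) := det3_pluecker (p 1).rep (p 0).rep (p 2).rep (p 3).rep (p d).rep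
  have pl4 := pl 4
  have pl5 := pl 5
  apply dilog_five_term <;> simp only [crFrom3]
  · simp [*]
  · simp [*]
  · simp [*]
  · field_simp
    linear_combination -det3 (p 1).rep (p 3).rep (p 5).rep * pl4
      + det3 (p 1).rep (p 3).rep (p 4).rep * pl5
  · field_simp
  · field_simp

/-- The triple ratio of `p` with its points permuted so that `Δ(p 0, p 1, p 2)` occurs in the
numerator. -/
def swappedRatio (p : Fin 6 → Pt F 3) : F := tripleRatio F (p ∘ Equiv.swap 2 3)

/-- The quotient of the triple ratios of two configurations differing by the exchange of two
opposite points. -/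
def exchangeRatio (p : Fin 6 → Pt F 3) : F :=
  (det3 (p 1).rep (p 5).rep (p 4).rep * det3 (p 3).rep (p 0).rep (p 2).rep) /
    (det3 (p 1).rep (p 3).rep (p 4).rep * det3 (p 5).rep (p 0).rep (p 2).rep)

lemma swappedRatio_eq (p : Fin 6 → Pt F 3) :
    swappedRatio p =
      (det3 (p 0).rep (p 1).rep (p 2).rep * det3 (p 1).rep (p 3).rep (p 4).rep *
        det3 (p 3).rep (p 0).rep (p 5).rep) /
      (det3 (p 0).rep (p 1).rep (p 4).rep * det3 (p 1).rep (p 3).rep (p 5).rep *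
        det3 (p 3).rep (p 0).rep (p 2).rep) := by
  rfl

lemma swappedRatio_comp_swap_eq (p : Fin 6 → Pt F 3) :
    swappedRatio (p ∘ Equiv.swap 3 5) =
      (det3 (p 0).rep (p 1).rep (p 2).rep * det3 (p 1).rep (p 5).rep (p 4).rep *
        det3 (p 5).rep (p 0).rep (p 3).rep) /
      (det3 (p 0).rep (p 1).rep (p 4).rep * det3 (p 1).rep (p 5).rep (p 3).rep *
        det3 (p 5).rep (p 0).rep (p 2).rep) := by
  rfl

lemma exchangeRatio_comp_swap (p : Fin 6 → Pt F 3) :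
    exchangeRatio (p ∘ Equiv.swap 0 2) = exchangeRatio p := by
  have h (e : Fin 3 → F) := det3_swap_right e (p 0).rep (p 2).rep
  have h' : exchangeRatio (p ∘ Equiv.swap 0 2) =
      (det3 (p 1).rep (p 5).rep (p 4).rep * det3 (p 3).rep (p 2).rep (p 0).rep) /
        (det3 (p 1).rep (p 3).rep (p 4).rep * det3 (p 5).rep (p 2).rep (p 0).rep) := rfl
  rw [h', exchangeRatio, h, h, mul_neg, mul_neg, neg_div_neg_eq]

/-- The five-term relation comparing the triple ratios of two configurations which differ by the
exchange of two opposite points. -/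
lemma dilog_swappedRatio {p : Fin 6 → Pt F 3} (hp : Generic6 p) :
    crDilog 1 0 4 5 3 p - crDilog 0 1 2 5 3 p + dilog (exchangeRatio p)
      - dilog (swappedRatio (p ∘ Equiv.swap 3 5)) + dilog (swappedRatio p) = 0 := by
  have h013 := hp 0 1 3 (by decide) (by decide) (by decide)
  have h012 := hp 0 1 2 (by decide) (by decide) (by decide)
  have h014 := hp 0 1 4 (by decide) (by decide) (by decide)
  have h015 := hp 0 1 5 (by decide) (by decide) (by decide)
  have h032 := hp 0 3 2 (by decide) (by decide) (by decide)
  have h035 := hp 0 3 5 (by decide) (by decide) (by decide)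
  have h025 := hp 0 2 5 (by decide) (by decide) (by decide)
  have h134 := hp 1 3 4 (by decide) (by decide) (by decide)
  have h135 := hp 1 3 5 (by decide) (by decide) (by decide)
  have h145 := hp 1 4 5 (by decide) (by decide) (by decide)
  have k1 := det3_triple_ratio (p 0).rep (p 1).rep (p 3).rep (p 2).rep (p 4).rep (p 5).rep
  have k2 := det3_triple_ratio (p 0).rep (p 1).rep (p 5).rep (p 2).rep (p 4).rep (p 3).rep
  have e305 := det3_swap_left (p 0).rep (p 3).rep (p 5).rep
  have e302 := det3_swap_left (p 0).rep (p 3).rep (p 2).rep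
  have e154 := det3_swap_right (p 1).rep (p 4).rep (p 5).rep
  have e503 := (det3_rotate (p 5).rep (p 0).rep (p 3).rep).symm
  have e153 := det3_swap_right (p 1).rep (p 3).rep (p 5).rep
  have e502 := (det3_rotate (p 5).rep (p 0).rep (p 2).rep).symm
  have e023 := det3_swap_right (p 0).rep (p 3).rep (p 2).rep
  have e103 := det3_swap_left (p 0).rep (p 1).rep (p 3).rep
  have e105 := det3_swap_left (p 0).rep (p 1).rep (p 5).rep
  have e143 := det3_swap_right (p 1).rep (p 3).rep (p 4).rep
  have e453 := det3_swap_right (p 4).rep (p 3).rep (p 5).rep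
  rw [e305, e302] at k1
  rw [e154, e503, e153, e502, e453] at k2
  rw [swappedRatio_comp_swap_eq, swappedRatio_eq]
  apply dilog_five_term <;>
    simp only [crFrom3, exchangeRatio, e305, e302, e154, e503, e153, e502, e023, e103, e105, e143]
  · simp [*]
  · simp [*]
  · simp [*]
  · field_simp
    linear_combination
      -det3 (p 0).rep (p 1).rep (p 5).rep * k1
      - det3 (p 0).rep (p 1).rep (p 3).rep * k2
  · field_simp
  · field_simp

/-! ### Alternating sums over the symmetric group -/

section AltSum

variable {M : Type*} [AddCommGroup M]

/-- The alternating sum of a function of six points over all their permutations. -/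
def altSum (x : Fin 6 → Pt F 3) (h : (Fin 6 → Pt F 3) → M) : M :=
  ∑ σ : Equiv.Perm (Fin 6), (Equiv.Perm.sign σ : ℤ) • h (x ∘ σ)

lemma altSum_congr {x : Fin 6 → Pt F 3} (hx : Generic6 x) {h k : (Fin 6 → Pt F 3) → M}
    (hhk : ∀ p, Generic6 p → h p = k p) : altSum x h = altSum x k :=
  Finset.sum_congr rfl fun σ _ => by rw [hhk _ (hx.comp σ)]

lemma altSum_comp (x : Fin 6 → Pt F 3) (h : (Fin 6 → Pt F 3) → M) (τ : Equiv.Perm (Fin 6)) :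
    altSum x (fun p => h (p ∘ τ)) = (Equiv.Perm.sign τ : ℤ) • altSum x h := by
  rw [altSum, altSum, ← Equiv.sum_comp (Equiv.mulRight τ) fun σ =>
    (Equiv.Perm.sign σ : ℤ) • h (x ∘ σ), Finset.smul_sum]
  refine Finset.sum_congr rfl fun σ _ => ?_
  rw [Equiv.coe_mulRight, Equiv.Perm.sign_mul, smul_smul, Units.val_mul, mul_left_comm,
    Int.units_coe_mul_self, mul_one]
  rfl

lemma altSum_comp_swap (x : Fin 6 → Pt F 3) (h : (Fin 6 → Pt F 3) → M) {i j : Fin 6}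
    (hij : i ≠ j) : altSum x (fun p => h (p ∘ Equiv.swap i j)) = -altSum x h := by
  rw [altSum_comp, Equiv.Perm.sign_swap hij]
  simp

lemma altSum_add (x : Fin 6 → Pt F 3) (h k : (Fin 6 → Pt F 3) → M) :
    altSum x (fun p => h p + k p) = altSum x h + altSum x k := by
  simp only [altSum, smul_add, Finset.sum_add_distrib]

lemma altSum_neg (x : Fin 6 → Pt F 3) (h : (Fin 6 → Pt F 3) → M) :
    altSum x (fun p => -h p) = -altSum x h := by
  simp only [altSum, smul_neg, Finset.sum_neg_distrib]

lemma altSum_sub (x : Fin 6 → Pt F 3) (h k : (Fin 6 → Pt F 3) → M) :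
    altSum x (fun p => h p - k p) = altSum x h - altSum x k := by
  simp only [altSum, smul_sub, Finset.sum_sub_distrib]

end AltSum

/-- The class in `F^* ⊗ ℚ` of the determinant of three of six points of the plane. -/
def fsDet (i j k : Fin 6) (p : Fin 6 → Pt F 3) : FS F :=
  fs F (det3 (p i).rep (p j).rep (p k).rep)

lemma fsDet_swap_left (i j k : Fin 6) : fsDet (F := F) j i k = fsDet i j k := by
  funext p; rw [fsDet, det3_swap_left, fs_neg, fsDet]

lemma fsDet_swap_right (i j k : Fin 6) : fsDet (F := F) i k j = fsDet i j k := by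
  funext p; rw [fsDet, det3_swap_right, fs_neg, fsDet]

lemma fsDet_reverse (i j k : Fin 6) : fsDet (F := F) k j i = fsDet i j k := by
  rw [fsDet_swap_left, fsDet_swap_right, fsDet_swap_left]

/-- The alternating sum of `g ⊗ Δ(p 0, p 1, p 2)`. -/
def altDet (x : Fin 6 → Pt F 3) : ((Fin 6 → Pt F 3) → B2 F) →ₗ[ℚ] T21 F where
  toFun g := altSum x fun p => g p ⊗ₜ[ℚ] fsDet 0 1 2 p
  map_add' g g' := by simp only [Pi.add_apply, TensorProduct.add_tmul, altSum_add]
  map_smul' r g := by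
    simp only [altSum, Pi.smul_apply, ← TensorProduct.smul_tmul', Finset.smul_sum,
      RingHom.id_apply]
    exact Finset.sum_congr rfl fun σ _ => smul_comm _ _ _

lemma altDet_apply (x : Fin 6 → Pt F 3) (g : (Fin 6 → Pt F 3) → B2 F) :
    altDet x g = altSum x fun p => g p ⊗ₜ[ℚ] fsDet 0 1 2 p := by
  rw [altDet, LinearMap.coe_mk, AddHom.coe_mk]

lemma altDet_eq_zero {x : Fin 6 → Pt F 3} (hx : Generic6 x) {g : (Fin 6 → Pt F 3) → B2 F}
    (hg : ∀ p, Generic6 p → g p = 0) : altDet x g = 0 := by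
  rw [altDet_apply, altSum]
  refine Finset.sum_eq_zero fun σ _ => ?_
  rw [hg _ (hx.comp σ), TensorProduct.zero_tmul, smul_zero]

lemma altDet_comp_swap (x : Fin 6 → Pt F 3) (g : (Fin 6 → Pt F 3) → B2 F) {i j : Fin 6}
    (hij : i ≠ j) (hdet : fsDet (F := F) (Equiv.swap i j 0) (Equiv.swap i j 1) (Equiv.swap i j 2) =
      fsDet 0 1 2) : altDet x (fun p => g (p ∘ Equiv.swap i j)) = -altDet x g := by
  have hdet' (p : Fin 6 → Pt F 3) : fsDet 0 1 2 (p ∘ Equiv.swap i j) = fsDet 0 1 2 p :=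
    congrFun hdet p
  rw [altDet_apply, altDet_apply,
    ← altSum_comp_swap x (fun p => g p ⊗ₜ[ℚ] fsDet 0 1 2 p) hij]
  simp only [hdet']

lemma altDet_crDilog_swap (x : Fin 6 → Pt F 3) {i j : Fin 6} (hij : i ≠ j)
    (hdet : fsDet (F := F) (Equiv.swap i j 0) (Equiv.swap i j 1) (Equiv.swap i j 2) =
      fsDet 0 1 2) (e a b c d : Fin 6) :
    altDet x (crDilog (Equiv.swap i j e) (Equiv.swap i j a) (Equiv.swap i j b) (Equiv.swap i j c)
      (Equiv.swap i j d)) = -altDet x (crDilog e a b c d) :=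
  altDet_comp_swap x (crDilog e a b c d) hij hdet

lemma altDet_crDilog_centre_one (x : Fin 6 → Pt F 3) (c d : Fin 6)
    (hc : Equiv.swap 0 1 c = c) (hd : Equiv.swap 0 1 d = d) :
    altDet x (crDilog 1 0 2 c d) = -altDet x (crDilog 0 1 2 c d) := by
  have h := altDet_crDilog_swap x (i := 0) (j := 1) (by decide) (fsDet_swap_left 0 1 2) 0 1 2 c d
  rwa [hc, hd] at h

lemma altDet_crDilog_centre_two (x : Fin 6 → Pt F 3) (c d : Fin 6)
    (hc : Equiv.swap 1 2 c = c) (hd : Equiv.swap 1 2 d = d) :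
    altDet x (crDilog 2 0 1 c d) = -altDet x (crDilog 1 0 2 c d) := by
  have h := altDet_crDilog_swap x (i := 1) (j := 2) (by decide) (fsDet_swap_right 0 1 2) 1 0 2 c d
  rwa [hc, hd] at h

lemma altDet_crDilog_three_five (x : Fin 6 → Pt F 3) :
    altDet x (crDilog 0 1 2 3 5) = -altDet x (crDilog 0 1 2 4 5) :=
  altDet_crDilog_swap x (i := 3) (j := 4) (by decide) rfl 0 1 2 4 5

lemma altDet_crDilog_three_four (x : Fin 6 → Pt F 3) :
    altDet x (crDilog 0 1 2 3 4) = altDet x (crDilog 0 1 2 4 5) := by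
  have h : altDet x (crDilog 0 1 2 3 4) = -altDet x (crDilog 0 1 2 3 5) :=
    altDet_crDilog_swap x (i := 4) (j := 5) (by decide) rfl 0 1 2 3 5
  rw [h, altDet_crDilog_three_five, neg_neg]

/-- The nine cross-ratios in `⟨p 0, p 1, p 2; p 3, p 4, p 5⟩_2` contribute equally. -/
lemma altDet_a2free (x : Fin 6 → Pt F 3) :
    altDet x (fun p => clsB2 F (a2free ![p 0, p 1, p 2] ![p 3, p 4, p 5])) =
      (9 : ℚ) • altDet x (crDilog 0 1 2 4 5) := by
  have h : (fun p : Fin 6 → Pt F 3 => clsB2 F (a2free ![p 0, p 1, p 2] ![p 3, p 4, p 5])) =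
      (crDilog 0 1 2 4 5 - crDilog 0 1 2 3 5 + crDilog 0 1 2 3 4)
      - (crDilog 1 0 2 4 5 - crDilog 1 0 2 3 5 + crDilog 1 0 2 3 4)
      + (crDilog 2 0 1 4 5 - crDilog 2 0 1 3 5 + crDilog 2 0 1 3 4) := by
    funext p
    have h00 : (0 : Fin 3).succAbove (0 : Fin 2) = 1 := by decide
    have h01 : (0 : Fin 3).succAbove (1 : Fin 2) = 2 := by decide
    have h10 : (1 : Fin 3).succAbove (0 : Fin 2) = 0 := by decide
    have h11 : (1 : Fin 3).succAbove (1 : Fin 2) = 2 := by decide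
    have h20 : (2 : Fin 3).succAbove (0 : Fin 2) = 0 := by decide
    have h21 : (2 : Fin 3).succAbove (1 : Fin 2) = 1 := by decide
    simp only [a2free, Fin.sum_univ_three, h00, h01, h10, h11, h20, h21, map_add, map_zsmul,
      Fin.val_zero, Fin.val_one, Fin.val_two, Pi.add_apply, Pi.sub_apply, crDilog, dilog,
      Matrix.cons_val]
    module
  simp only [h, map_add, map_sub]
  rw [altDet_crDilog_centre_two x 4 5 (by decide) (by decide),
    altDet_crDilog_centre_two x 3 5 (by decide) (by decide),
    altDet_crDilog_centre_two x 3 4 (by decide) (by decide),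
    altDet_crDilog_centre_one x 4 5 (by decide) (by decide),
    altDet_crDilog_centre_one x 3 5 (by decide) (by decide),
    altDet_crDilog_centre_one x 3 4 (by decide) (by decide),
    altDet_crDilog_three_five, altDet_crDilog_three_four]
  module

/-- Projecting from a point of the first triple, with two points of the same triple or with one. -/
lemma altDet_crDilog_mixed {x : Fin 6 → Pt F 3} (hx : Generic6 x) :
    (2 : ℚ) • altDet x (crDilog 1 0 3 4 5) = (-3 : ℚ) • altDet x (crDilog 0 1 2 4 5) := by
  have h : altDet x (crDilog 1 2 3 4 5 - crDilog 1 0 3 4 5 + crDilog 1 0 2 4 5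
      - crDilog 1 0 2 3 5 + crDilog 1 0 2 3 4) = 0 :=
    altDet_eq_zero hx fun p hp => crDilog_five_term hp
  have h2 : altDet x (crDilog 1 2 3 4 5) = -altDet x (crDilog 1 0 3 4 5) :=
    altDet_crDilog_swap x (i := 0) (j := 2) (by decide) (fsDet_reverse 0 1 2) 1 0 3 4 5
  simp only [map_add, map_sub] at h
  rw [h2, altDet_crDilog_centre_one x 4 5 (by decide) (by decide),
    altDet_crDilog_centre_one x 3 5 (by decide) (by decide),
    altDet_crDilog_centre_one x 3 4 (by decide) (by decide),
    altDet_crDilog_three_five, altDet_crDilog_three_four] at h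
  rw [← sub_eq_zero, ← neg_eq_zero, ← h]
  module

/-- The alternating sum of the dilogarithm of the triple ratio in terms of cross-ratios. -/
lemma altDet_swappedRatio {x : Fin 6 → Pt F 3} (hx : Generic6 x) :
    altDet x (fun p => dilog (swappedRatio p)) =
      (5 / 4 : ℚ) • altDet x (crDilog 0 1 2 4 5) := by
  have h : altDet x (crDilog 1 0 4 5 3 - crDilog 0 1 2 5 3 + (fun p => dilog (exchangeRatio p))
      - (fun p => dilog (swappedRatio (p ∘ Equiv.swap 3 5)))
      + (fun p => dilog (swappedRatio p))) = 0 :=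
    altDet_eq_zero hx fun p hp => dilog_swappedRatio hp
  have hs : altDet x (fun p => dilog (swappedRatio (p ∘ Equiv.swap 3 5))) =
      -altDet x fun p => dilog (swappedRatio p) :=
    altDet_comp_swap x (fun p => dilog (swappedRatio p)) (by decide) rfl
  have hw : altDet x (fun p => dilog (exchangeRatio p)) = 0 := by
    have h' := altDet_comp_swap x (fun p => dilog (exchangeRatio p)) (i := 0) (j := 2) (by decide)
      (fsDet_reverse 0 1 2)
    simp only [exchangeRatio_comp_swap] at h'
    rw [eq_neg_iff_add_eq_zero, ← two_smul ℚ] at h'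
    exact (smul_eq_zero.1 h').resolve_left two_ne_zero
  have h1 : altDet x (crDilog 0 1 2 5 3) = -altDet x (crDilog 0 1 2 3 5) :=
    altDet_crDilog_swap x (i := 3) (j := 5) (by decide) rfl 0 1 2 3 5
  have h2 : altDet x (crDilog 1 0 4 5 3) = -altDet x (crDilog 1 0 4 3 5) :=
    altDet_crDilog_swap x (i := 3) (j := 5) (by decide) rfl 1 0 4 3 5
  have h3 : altDet x (crDilog 1 0 4 3 5) = -altDet x (crDilog 1 0 3 4 5) :=
    altDet_crDilog_swap x (i := 3) (j := 4) (by decide) rfl 1 0 3 4 5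
  have h4 := altDet_crDilog_mixed hx
  simp only [map_add, map_sub] at h
  rw [hs, hw, h1, h2, h3, altDet_crDilog_three_five] at h
  linear_combination (norm := module) (1 / 2 : ℚ) • h - (1 / 4 : ℚ) • h4

/-! ### The symmetries of the triple ratio -/

/-- The cyclic symmetry of the triple ratio. -/
def ratioRotation : Equiv.Perm (Fin 6) :=
  Equiv.swap 0 1 * Equiv.swap 1 2 * (Equiv.swap 3 4 * Equiv.swap 4 5)

/-- The symmetry of the triple ratio which inverts it. -/
def ratioInversion : Equiv.Perm (Fin 6) := Equiv.swap 0 1 * Equiv.swap 3 4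

lemma sign_ratioRotation : Equiv.Perm.sign ratioRotation = 1 := by
  simp [ratioRotation]

lemma sign_ratioInversion : Equiv.Perm.sign ratioInversion = 1 := by
  simp [ratioInversion]

lemma tripleRatio_comp_rotation (p : Fin 6 → Pt F 3) :
    tripleRatio F (p ∘ ratioRotation) = tripleRatio F p := by
  have h : tripleRatio F (p ∘ ratioRotation) =
      (det3 (p 1).rep (p 2).rep (p 4).rep * det3 (p 2).rep (p 0).rep (p 5).rep *
        det3 (p 0).rep (p 1).rep (p 3).rep) /
      (det3 (p 1).rep (p 2).rep (p 5).rep * det3 (p 2).rep (p 0).rep (p 3).rep *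
        det3 (p 0).rep (p 1).rep (p 4).rep) := rfl
  rw [h, tripleRatio]
  congr 1 <;> ring

lemma tripleRatio_comp_inversion (p : Fin 6 → Pt F 3) :
    tripleRatio F (p ∘ ratioInversion) = (tripleRatio F p)⁻¹ := by
  have h : tripleRatio F (p ∘ ratioInversion) =
      (det3 (p 1).rep (p 0).rep (p 4).rep * det3 (p 0).rep (p 2).rep (p 3).rep *
        det3 (p 2).rep (p 1).rep (p 5).rep) /
      (det3 (p 1).rep (p 0).rep (p 3).rep * det3 (p 0).rep (p 2).rep (p 5).rep *
        det3 (p 2).rep (p 1).rep (p 4).rep) := rfl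
  rw [h, tripleRatio, inv_div, det3_swap_left (p 0).rep (p 1).rep,
    det3_swap_left (p 0).rep (p 1).rep,
    det3_swap_left (p 2).rep (p 0).rep, det3_swap_left (p 2).rep (p 0).rep,
    det3_swap_left (p 1).rep (p 2).rep, det3_swap_left (p 1).rep (p 2).rep]
  rw [← neg_div_neg_eq]
  congr 1 <;> ring

/-- The alternating sum of the dilogarithm of the triple ratio times a determinant. -/
def altRatio (x : Fin 6 → Pt F 3) (i j k : Fin 6) : T21 F :=
  altSum x fun p => dilog (tripleRatio F p) ⊗ₜ[ℚ] fsDet i j k p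

lemma altRatio_rotation (x : Fin 6 → Pt F 3) (i j k : Fin 6) :
    altRatio x (ratioRotation i) (ratioRotation j) (ratioRotation k) = altRatio x i j k := by
  have h := altSum_comp x (fun p => dilog (tripleRatio F p) ⊗ₜ[ℚ] fsDet i j k p) ratioRotation
  simp only [tripleRatio_comp_rotation, sign_ratioRotation, Units.val_one, one_smul] at h
  exact h

lemma altRatio_inversion {x : Fin 6 → Pt F 3} (hx : Generic6 x) (i j k : Fin 6) :
    altRatio x (ratioInversion i) (ratioInversion j) (ratioInversion k) = -altRatio x i j k := by
  have h := altSum_comp x (fun p => dilog (tripleRatio F p) ⊗ₜ[ℚ] fsDet i j k p) ratioInversion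
  simp only [tripleRatio_comp_inversion, sign_ratioInversion, Units.val_one, one_smul,
    dilog_inv hx.exists_ne, TensorProduct.neg_tmul, altSum_neg] at h
  rw [altRatio, altRatio, ← h, neg_neg]
  rfl

/-- All determinants occurring in the triple ratio contribute equally. -/
lemma altSum_dilog_tmul_fs {x : Fin 6 → Pt F 3} (hx : Generic6 x) :
    altSum x (fun p => dilog (tripleRatio F p) ⊗ₜ[ℚ] fs F (tripleRatio F p)) =
      (6 : ℚ) • altRatio x 0 1 3 := by
  have h : altSum x (fun p => dilog (tripleRatio F p) ⊗ₜ[ℚ] fs F (tripleRatio F p)) =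
      altRatio x 0 1 3 + altRatio x 1 2 4 + altRatio x 2 0 5 - altRatio x 0 1 4
        - altRatio x 1 2 5 - altRatio x 2 0 3 := by
    simp only [altRatio, ← altSum_add, ← altSum_sub, ← TensorProduct.tmul_add,
      ← TensorProduct.tmul_sub]
    refine altSum_congr hx fun p hp => ?_
    rw [tripleRatio, fs_triple_div (hp 0 1 3 (by decide) (by decide) (by decide))
      (hp 1 2 4 (by decide) (by decide) (by decide)) (hp 2 0 5 (by decide) (by decide) (by decide))
      (hp 0 1 4 (by decide) (by decide) (by decide)) (hp 1 2 5 (by decide) (by decide) (by decide))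
      (hp 2 0 3 (by decide) (by decide) (by decide))]
    rfl
  have h124 : altRatio x 1 2 4 = altRatio x 0 1 3 := altRatio_rotation x 0 1 3
  have h205 : altRatio x 2 0 5 = altRatio x 1 2 4 := altRatio_rotation x 1 2 4
  have h125 : altRatio x 1 2 5 = altRatio x 0 1 4 := altRatio_rotation x 0 1 4
  have h203 : altRatio x 2 0 3 = altRatio x 1 2 5 := altRatio_rotation x 1 2 5
  have h014 : altRatio x 0 1 4 = -altRatio x 0 1 3 := by
    have h' : altRatio x 1 0 4 = -altRatio x 0 1 3 := altRatio_inversion hx 0 1 3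
    rwa [altRatio, fsDet_swap_left] at h'
  rw [h, h203, h125, h205, h124, h014]
  module

lemma altRatio_eq_altDet (x : Fin 6 → Pt F 3) :
    altRatio x 0 1 3 = -altDet x fun p => dilog (swappedRatio p) := by
  rw [eq_neg_iff_add_eq_zero, ← neg_eq_iff_add_eq_zero]
  exact (altSum_comp_swap x (fun p => dilog (tripleRatio F p) ⊗ₜ[ℚ] fsDet 0 1 3 p)
    (i := 2) (j := 3) (by decide)).symm

lemma Dmap_gen (a : F) : Dmap F (gen a) = dilog a ⊗ₜ[ℚ] fs F a := by
  obtain rfl | ha := eq_or_ne a 0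
  · simp [dilog_zero, gen]
  · simp [Dmap, gen, ha, dilog]

lemma Dmap_r3free (x : Fin 6 → Pt F 3) :
    Dmap F (r3free x) =
      (1 / 15 : ℚ) • altSum x fun p => dilog (tripleRatio F p) ⊗ₜ[ℚ] fs F (tripleRatio F p) := by
  simp only [r3free, altSum, map_smul, map_sum, map_zsmul, Dmap_gen]


/-- For six points `l_1,...,l_6` in generic position in `P²(F)`,
`D(r_3(l_1,...,l_6)) = -(1/18)·Alt_6( ⟨l_1,l_2,l_3;l_4,l_5,l_6⟩_2 ⊗ Δ(l_1,l_2,l_3) )`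
in `(B_2(F) ⊗ F^*) ⊗ ℚ`. -/
theorem statement4 (F : Type) [Field F] (x : Fin 6 → Pt F 3) (hx : Generic6 x) :
    Dmap F (r3free x) =
      (-(1 / 18) : ℚ) • ∑ σ : Equiv.Perm (Fin 6), (Equiv.Perm.sign σ : ℤ) •
        (clsB2 F (a2free ![x (σ 0), x (σ 1), x (σ 2)] ![x (σ 3), x (σ 4), x (σ 5)]) ⊗ₜ[ℚ]
          fs F (det3 (x (σ 0)).rep (x (σ 1)).rep (x (σ 2)).rep)) := by
  have h : ∑ σ : Equiv.Perm (Fin 6), (Equiv.Perm.sign σ : ℤ) •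
      (clsB2 F (a2free ![x (σ 0), x (σ 1), x (σ 2)] ![x (σ 3), x (σ 4), x (σ 5)]) ⊗ₜ[ℚ]
        fs F (det3 (x (σ 0)).rep (x (σ 1)).rep (x (σ 2)).rep)) =
      altDet x fun p => clsB2 F (a2free ![p 0, p 1, p 2] ![p 3, p 4, p 5]) := rfl
  rw [h, altDet_a2free, Dmap_r3free, altSum_dilog_tmul_fs hx, altRatio_eq_altDet,
    altDet_swappedRatio hx]
  module

end Gon
end
end

section
/- For every admissible pair of tetrahedra (L;M) in generic position in P³(F), one has a_3'(L;M) = a_3'(M;L) and a_3''(L;M) = a_3''(M;L) in B_3(F) ⊗ ℚ. -/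
noncomputable section
open scoped TensorProduct
open Classical

namespace Gon

variable (F : Type) [Field F]

variable {F}

/-- `Δ` of four vectors of `F^4`. -/
def det4 (a b c d : Fin 4 → F) : F := dt ![a, b, c, d]

/-- Cross-ratio of the four points of `P^1` obtained by projecting `a b c d` from the
line through `p` and `q` in `P^3`. -/
def crLine (p q a b c d : Pt F 4) : F :=
  (det4 p.rep q.rep a.rep c.rep * det4 p.rep q.rep b.rep d.rep) /
    (det4 p.rep q.rep a.rep d.rep * det4 p.rep q.rep b.rep c.rep)

variable (F)

variable {F}

variable (F)

/-- `{x}_2 ∈ B_2(F)`. -/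
def b2 (a : F) : B2 F := clsB2 F (gen a)

variable {F}

variable (F)

variable {F}

/-- Kummer's functional equation for the trilogarithm. -/
def kummer (x y : F) : QF F :=
  -gen (x * (1 - y) ^ 2 / (y * (1 - x) ^ 2)) - gen (x * y) - gen (x / y) - (2 : ℚ) • gen 1 +
    (2 : ℚ) • (gen (-x * (1 - y) / (1 - x)) + gen (x * (1 - y) / (y * (1 - x))) +
      gen (-y * (1 - x) / (1 - y)) + gen ((1 - x) / (1 - y)) + gen y + gen x)

variable (F)

/-- `R_3(F)`: generated by `{x} - {x⁻¹}`, the seven term relations for seven generic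
points of the plane, and Kummer's relations. -/
def R3 : Submodule ℚ (QF F) :=
  Submodule.span ℚ
    ({z | ∃ x : F, z = gen x - gen x⁻¹} ∪
      {z | ∃ x : Fin 7 → Pt F 3, (∀ i j k : Fin 7, i ≠ j → i ≠ k → j ≠ k →
          det3 (x i).rep (x j).rep (x k).rep ≠ 0) ∧
          z = ∑ i : Fin 7, ((-1 : ℤ) ^ (i : ℕ)) • r3free (x ∘ i.succAbove)} ∪
      {z | ∃ x y : F, x ≠ 0 ∧ x ≠ 1 ∧ y ≠ 0 ∧ y ≠ 1 ∧ z = kummer x y})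

/-- `B_3(F)` (tensored with `ℚ`). -/
abbrev B3 := QF F ⧸ R3 F

def clsB3 : QF F →ₗ[ℚ] B3 F := (R3 F).mkQ

/-- `{x}_3 ∈ B_3(F)`. -/
def b3 (a : F) : B3 F := clsB3 F (gen a)

variable {F}

/-- `μ_3`, relative to a given cross-ratio function `cr` (18 terms, with the factor 1/4):
`μ_3(x_1,x_2,x_3;y_1,y_2,y_3) = (1/4)·Alt_{(x)(y)}({r(x_1,y_2,x_2,y_1)} - {r(x_1,y_1,x_2,y_2)})`. -/
def mu3 {P : Type} (cr : P → P → P → P → F) (x y : Fin 3 → P) : QF F :=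
  (1 / 4 : ℚ) • ∑ σ : Equiv.Perm (Fin 3), ∑ τ : Equiv.Perm (Fin 3),
    (((Equiv.Perm.sign σ : ℤ) * (Equiv.Perm.sign τ : ℤ)) : ℤ) •
      (gen (cr (x (σ 0)) (y (τ 1)) (x (σ 1)) (y (τ 0))) -
        gen (cr (x (σ 0)) (y (τ 0)) (x (σ 1)) (y (τ 1))))

/-- triple ratio of the configuration of six points of `P^2` obtained by projecting the
six points `z` of `P^3` from the centre `e`. -/
def tripleRatioFrom4 (e : Pt F 4) (z : Fin 6 → Pt F 4) : F :=
  (det4 e.rep (z 0).rep (z 1).rep (z 3).rep * det4 e.rep (z 1).rep (z 2).rep (z 4).rep *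
      det4 e.rep (z 2).rep (z 0).rep (z 5).rep) /
    (det4 e.rep (z 0).rep (z 1).rep (z 4).rep * det4 e.rep (z 1).rep (z 2).rep (z 5).rep *
      det4 e.rep (z 2).rep (z 0).rep (z 3).rep)

/-- `r_3` of the configuration of six points of `P^2` obtained by projection from `e ∈ P^3`. -/
def r3From4 (e : Pt F 4) (z : Fin 6 → Pt F 4) : QF F :=
  (1 / 15 : ℚ) • ∑ σ : Equiv.Perm (Fin 6), (Equiv.Perm.sign σ : ℤ) •
    gen (tripleRatioFrom4 e (z ∘ σ))

/-- `a_3'(l_0,...,l_3;m_0,...,m_3) = Σ_{i,j} (-1)^{i+j} r_3(l_i | l̂_i; m̂_j)`. -/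
def a3p (l m : Fin 4 → Pt F 4) : QF F :=
  ∑ i : Fin 4, ∑ j : Fin 4, ((-1 : ℤ) ^ ((i : ℕ) + (j : ℕ))) •
    r3From4 (l i) ![l (i.succAbove 0), l (i.succAbove 1), l (i.succAbove 2),
      m (j.succAbove 0), m (j.succAbove 1), m (j.succAbove 2)]

/-- `a_3''(l_0,...,l_3;m_0,...,m_3) = Σ_{i,j} (-1)^{i+j} μ_3(l_i,m_j | l̂_i; m̂_j)`,
the cross-ratios being taken after projection from the line through `l_i` and `m_j`. -/
def a3pp (l m : Fin 4 → Pt F 4) : QF F :=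
  ∑ i : Fin 4, ∑ j : Fin 4, ((-1 : ℤ) ^ ((i : ℕ) + (j : ℕ))) •
    mu3 (crLine (l i) (m j)) (l ∘ i.succAbove) (m ∘ j.succAbove)

/-- `a_3 = (1/6)·a_3' - (1/3)·a_3''` (at the level of `ℚ[F]`). -/
def a3free (l m : Fin 4 → Pt F 4) : QF F :=
  (1 / 6 : ℚ) • a3p l m - (1 / 3 : ℚ) • a3pp l m

/-- A pair of tetrahedra in `P^3` is in generic position when any four of the eight
vertices are projectively independent. -/
def GenericPair (l m : Fin 4 → Pt F 4) : Prop :=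
  ∀ a b c d : Fin 8, a ≠ b → a ≠ c → a ≠ d → b ≠ c → b ≠ d → c ≠ d →
    det4 ((Fin.append l m a).rep) ((Fin.append l m b).rep)
      ((Fin.append l m c).rep) ((Fin.append l m d).rep) ≠ 0

section Duality

variable {F : Type} [Field F]

/-- The minors of the orthogonal complement of the column space of a matrix are, up to sign,
the complementary minors of the matrix. -/
theorem det_orthogonal_minor {m n : Type} [Fintype m] [Fintype n] [DecidableEq m] [DecidableEq n]
    (C : Matrix m n F) (σ : Equiv.Perm (m ⊕ n)) :
    ((Matrix.fromRows (1 : Matrix m m F) (-C.transpose)).submatrix (σ ∘ Sum.inl) id).det =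
      (Equiv.Perm.sign σ : ℤ) *
        ((Matrix.fromRows C (1 : Matrix n n F)).submatrix (σ ∘ Sum.inr) id).det := by
  set X := Matrix.fromRows C (1 : Matrix n n F) with hX
  set Y := Matrix.fromRows (1 : Matrix m m F) (-C.transpose) with hY
  set W := Matrix.fromRows (0 : Matrix m n F) (1 : Matrix n n F) with hW
  set P := Matrix.fromCols Y W with hP
  set Q := Matrix.fromCols
    (Matrix.fromRows (1 : Matrix m m F) (0 : Matrix n m F)) (X.submatrix σ id) with hQ
  have hdP : P.det = 1 := by
    have : P = Matrix.fromBlocks 1 0 (-C.transpose) 1 := by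
      ext (i | i) (j | j) <;> simp [hP, hY, hW]
    rw [this, Matrix.det_fromBlocks_zero₁₂]
    simp
  have hdQ : Q.det = (X.submatrix (σ ∘ Sum.inr) id).det := by
    have : Q = Matrix.fromBlocks 1 (X.submatrix (σ ∘ Sum.inl) id) 0
        (X.submatrix (σ ∘ Sum.inr) id) := by
      ext (i | i) (j | j) <;> simp [hQ]
    rw [this, Matrix.det_fromBlocks_zero₂₁]
    simp
  have hYX : Y.transpose * X = 0 := by
    rw [hY, hX, Matrix.transpose_fromRows, Matrix.fromCols_mul_fromRows]
    simp
  have hWX : W.transpose * X = 1 := by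
    rw [hW, hX, Matrix.transpose_fromRows, Matrix.fromCols_mul_fromRows]
    simp
  have hσ : ∀ (k : Type) (Z : Matrix (m ⊕ n) k F),
      (Z.submatrix σ id).transpose * X.submatrix σ id = Z.transpose * X := by
    intro k Z
    rw [Matrix.transpose_submatrix, Matrix.submatrix_mul_equiv, Matrix.submatrix_id_id]
  have hPQ : (P.submatrix σ id).transpose * Q = Matrix.fromBlocks
      (Y.submatrix (σ ∘ Sum.inl) id).transpose 0 (W.submatrix (σ ∘ Sum.inl) id).transpose 1 := by
    have h1 : P.submatrix σ id = Matrix.fromCols (Y.submatrix σ id) (W.submatrix σ id) := by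
      ext i (j | j) <;> simp [hP]
    rw [h1, hQ, Matrix.transpose_fromCols, Matrix.fromRows_mul_fromCols, hσ, hσ, hYX, hWX]
    congr 1 <;> ext i j <;> simp [Matrix.mul_apply, Matrix.one_apply]
  have hdet := congrArg Matrix.det hPQ
  rw [Matrix.det_mul, Matrix.det_transpose, Matrix.det_permute, hdP, hdQ,
    Matrix.det_fromBlocks_zero₁₂, Matrix.det_transpose] at hdet
  simpa using hdet.symm

/-- Gale duality between seven vectors of `F^4` and seven vectors of `F^3`: complementary brackets
are proportional up to sign. -/
theorem exists_gale_dual (x : Fin 7 → Fin 4 → F) (hx : det4 (x 3) (x 4) (x 5) (x 6) ≠ 0) :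
    ∃ y : Fin 7 → Fin 3 → F, ∃ c : F, c ≠ 0 ∧ ∀ π : Equiv.Perm (Fin 7),
      det4 (x (π 3)) (x (π 4)) (x (π 5)) (x (π 6)) =
        c * (Equiv.Perm.sign π : ℤ) * det3 (y (π 0)) (y (π 1)) (y (π 2)) := by
  set A : Matrix (Fin 4) (Fin 4) F := Matrix.of ![x 3, x 4, x 5, x 6] with hA
  have hA' : A.det ≠ 0 := hx
  have hAu : IsUnit A.det := isUnit_iff_ne_zero.2 hA'
  let ε : Fin 3 ⊕ Fin 4 ≃ Fin 7 := finSumFinEquiv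
  set C : Matrix (Fin 3) (Fin 4) F := Matrix.of ![x 0, x 1, x 2] * A⁻¹ with hC
  have hCA : Matrix.of ![x 0, x 1, x 2] = C * A := by
    rw [hC, Matrix.nonsing_inv_mul_cancel_right _ _ hAu]
  have hX : (Matrix.of x).submatrix ε id = Matrix.fromRows C 1 * A := by
    rw [Matrix.fromRows_mul, ← hCA, Matrix.one_mul, hA]
    ext (i | i) j <;> fin_cases i <;> rfl
  refine ⟨fun i => Matrix.fromRows 1 (-C.transpose) (ε.symm i), A.det, hA', fun π => ?_⟩
  have key := det_orthogonal_minor C ((ε.trans π).trans ε.symm)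
  have hs : Equiv.Perm.sign ((ε.trans π).trans ε.symm) = Equiv.Perm.sign π := by
    have := Equiv.Perm.sign_permCongr ε.symm π
    rwa [Equiv.permCongr_def, Equiv.symm_symm] at this
  rw [hs] at key
  have h3 : det3 (Matrix.fromRows 1 (-C.transpose) (ε.symm (π 0)))
      (Matrix.fromRows 1 (-C.transpose) (ε.symm (π 1)))
      (Matrix.fromRows 1 (-C.transpose) (ε.symm (π 2))) =
      ((Matrix.fromRows 1 (-C.transpose)).submatrix
        (((ε.trans π).trans ε.symm) ∘ Sum.inl) id).det := by
    unfold det3 dt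
    congr 1
    ext i j
    fin_cases i <;> rfl
  have h4 : det4 (x (π 3)) (x (π 4)) (x (π 5)) (x (π 6)) =
      ((Matrix.fromRows C 1).submatrix
        (((ε.trans π).trans ε.symm) ∘ Sum.inr) id).det * A.det := by
    rw [← Matrix.det_mul]
    have : (Matrix.fromRows C 1).submatrix (((ε.trans π).trans ε.symm) ∘ Sum.inr) id * A =
        ((Matrix.of x).submatrix ε id).submatrix (((ε.trans π).trans ε.symm) ∘ Sum.inr) id := by
      rw [hX]
      rfl
    rw [this]
    unfold det4 dt
    congr 1
    ext i j
    fin_cases i <;> simp <;> rfl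
  rw [h3, h4, key]
  rcases Int.units_eq_one_or (Equiv.Perm.sign π) with h | h <;> rw [h] <;> simp [mul_comm]

/-- Projecting from `e` expresses the brackets of `F^4` containing `e` by brackets of `F^3`. -/
theorem exists_projection (e a b c : Fin 4 → F) (h : det4 e a b c ≠ 0) :
    ∃ p : (Fin 4 → F) → Fin 3 → F, ∃ k : F, k ≠ 0 ∧ ∀ u v w : Fin 4 → F,
      det4 e u v w = k * det3 (p u) (p v) (p w) := by
  set A : Matrix (Fin 4) (Fin 4) F := Matrix.of ![e, a, b, c] with hA
  have hA' : A.det ≠ 0 := h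
  have hAu : IsUnit A.det := isUnit_iff_ne_zero.2 hA'
  refine ⟨fun u i => Matrix.vecMul u A⁻¹ i.succ, A.det, hA', fun u v w => ?_⟩
  have he : Matrix.vecMul e A⁻¹ = Pi.single 0 1 := by
    have h0 : Matrix.vecMul (Pi.single 0 1) A = e := by
      rw [Matrix.single_one_vecMul]
      rfl
    rw [← h0, Matrix.vecMul_vecMul, Matrix.mul_nonsing_inv _ hAu, Matrix.vecMul_one]
  have hM : Matrix.of ![e, u, v, w] = Matrix.of ![Matrix.vecMul e A⁻¹, Matrix.vecMul u A⁻¹,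
      Matrix.vecMul v A⁻¹, Matrix.vecMul w A⁻¹] * A := by
    have hv : ∀ t : Fin 4 → F, Matrix.vecMul (Matrix.vecMul t A⁻¹) A = t := fun t => by
      rw [Matrix.vecMul_vecMul, Matrix.nonsing_inv_mul _ hAu, Matrix.vecMul_one]
    ext i j
    fin_cases i
    exacts [(congrFun (hv e) j).symm, (congrFun (hv u) j).symm, (congrFun (hv v) j).symm,
      (congrFun (hv w) j).symm]
  unfold det4 dt
  rw [hM, Matrix.det_mul, mul_comm, he]
  congr 1
  rw [Matrix.det_succ_row_zero, Fin.sum_univ_succ]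
  simp only [Matrix.of_apply, Matrix.cons_val_zero, Pi.single_eq_same, Fin.succ_ne_zero, ne_eq,
    not_false_eq_true, Pi.single_eq_of_ne, mul_zero, zero_mul, Finset.sum_const_zero, add_zero]
  simp only [Fin.val_zero, pow_zero, one_mul]
  unfold det3 dt
  congr 1
  ext i j
  fin_cases i <;> simp

end Duality

section SevenTerm

variable {F : Type} [Field F]

/-- The triple ratio of six points with respect to a bracket `D`. -/
def bracketRatio {ι : Type} (D : ι → ι → ι → F) (z : Fin 6 → ι) : F :=
  (D (z 0) (z 1) (z 3) * D (z 1) (z 2) (z 4) * D (z 2) (z 0) (z 5)) /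
    (D (z 0) (z 1) (z 4) * D (z 1) (z 2) (z 5) * D (z 2) (z 0) (z 3))

/-- The generalized cross-ratio of six points with respect to a bracket `D`. -/
def r3Bracket {ι : Type} (D : ι → ι → ι → F) (z : Fin 6 → ι) : QF F :=
  (1 / 15 : ℚ) • ∑ σ : Equiv.Perm (Fin 6), (Equiv.Perm.sign σ : ℤ) • gen (bracketRatio D (z ∘ σ))

theorem r3Bracket_congr {ι κ : Type} {D : ι → ι → ι → F} {E : κ → κ → κ → F}
    {z : Fin 6 → ι} {w : Fin 6 → κ}
    (h : ∀ σ : Equiv.Perm (Fin 6), bracketRatio D (z ∘ σ) = bracketRatio E (w ∘ σ)) :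
    r3Bracket D z = r3Bracket E w := by
  simp only [r3Bracket, h]

theorem bracketRatio_const_mul {ι : Type} (D : ι → ι → ι → F) {k : F} (hk : k ≠ 0)
    (z : Fin 6 → ι) : bracketRatio (fun a b c => k * D a b c) z = bracketRatio D z := by
  unfold bracketRatio
  rw [← mul_div_mul_left (D _ _ _ * D _ _ _ * D _ _ _) _ (pow_ne_zero 3 hk)]
  congr 1 <;> ring

theorem r3Bracket_comp {ι : Type} (D : ι → ι → ι → F) (z : Fin 6 → ι) (ρ : Equiv.Perm (Fin 6)) :
    r3Bracket D (z ∘ ρ) = (Equiv.Perm.sign ρ : ℤ) • r3Bracket D z := by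
  unfold r3Bracket
  rw [smul_comm (Equiv.Perm.sign ρ : ℤ) (1 / 15 : ℚ) (_ : QF F)]
  refine congrArg (fun t : QF F => (1 / 15 : ℚ) • t) ?_
  rw [Finset.smul_sum]
  refine Fintype.sum_equiv (Equiv.mulLeft ρ) _ _ fun σ => ?_
  rw [smul_smul, Equiv.coe_mulLeft, Equiv.Perm.sign_mul, Units.val_mul, ← mul_assoc,
    ← Units.val_mul, Int.units_mul_self, Units.val_one, one_mul]
  rfl

theorem r3Bracket_eq_sign_smul {ι κ : Type} {D : ι → ι → ι → F} {E : κ → κ → κ → F}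
    {z : Fin 6 → ι} {w : Fin 6 → κ} (ρ : Equiv.Perm (Fin 6))
    (h : ∀ σ : Equiv.Perm (Fin 6), bracketRatio D (z ∘ σ) = bracketRatio E (w ∘ σ ∘ ρ)) :
    r3Bracket D z = (Equiv.Perm.sign ρ : ℤ) • r3Bracket E w := by
  unfold r3Bracket
  rw [smul_comm (Equiv.Perm.sign ρ : ℤ) (1 / 15 : ℚ) (_ : QF F)]
  refine congrArg (fun t : QF F => (1 / 15 : ℚ) • t) ?_
  rw [Finset.smul_sum]
  refine Fintype.sum_equiv (Equiv.mulRight ρ) _ _ fun σ => ?_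
  rw [smul_smul, Equiv.coe_mulRight, Equiv.Perm.sign_mul, Units.val_mul,
    mul_comm ((Equiv.Perm.sign σ : ℤˣ) : ℤ), ← mul_assoc, ← Units.val_mul, Int.units_mul_self,
    Units.val_one, one_mul, h]
  rfl

theorem det3_smul (a b c : F) (u v w : Fin 3 → F) :
    det3 (a • u) (b • v) (c • w) = a * b * c * det3 u v w := by
  simp [det3, dt, Matrix.det_fin_three]
  ring

/-- The seven-term relation for seven vectors of `F^3` in general position. -/
theorem seven_term_mem_R3 (y : Fin 7 → Fin 3 → F)
    (hy : ∀ i j k : Fin 7, i ≠ j → i ≠ k → j ≠ k → det3 (y i) (y j) (y k) ≠ 0) :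
    ∑ i : Fin 7, ((-1 : ℤ) ^ (i : ℕ)) •
      r3Bracket (fun a b c => det3 (y a) (y b) (y c)) i.succAbove ∈ R3 F := by
  have hne : ∀ i, y i ≠ 0 := by
    intro i hi
    obtain ⟨j, k, hij, hik, hjk⟩ : ∃ j k : Fin 7, i ≠ j ∧ i ≠ k ∧ j ≠ k := by
      clear hi
      revert i
      decide
    refine hy i j k hij hik hjk ?_
    simp [hi, det3, dt, Matrix.det_fin_three]
  let p : Fin 7 → Pt F 3 := fun i => Projectivization.mk F (y i) (hne i)
  have hp : ∀ i, ∃ a : Fˣ, a • y i = (p i).rep := fun i =>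
    Projectivization.exists_smul_eq_mk_rep F (y i) (hne i)
  choose a ha using hp
  have hdet : ∀ i j k, det3 (p i).rep (p j).rep (p k).rep =
      (a i * a j * a k : F) * det3 (y i) (y j) (y k) := by
    intro i j k
    rw [← ha, ← ha, ← ha]
    exact det3_smul _ _ _ _ _ _
  refine Submodule.subset_span (Or.inl (Or.inr ⟨p, fun i j k hij hik hjk => ?_, ?_⟩))
  · rw [hdet]
    exact mul_ne_zero (by simp) (hy i j k hij hik hjk)
  · refine Finset.sum_congr rfl fun i _ => ?_
    refine congrArg (fun t : QF F => ((-1 : ℤ) ^ (i : ℕ)) • t) ?_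
    unfold r3Bracket r3free
    refine congrArg _ (Finset.sum_congr rfl fun σ _ => ?_)
    refine congrArg (fun t : F => (Equiv.Perm.sign σ : ℤ) • gen t) ?_
    simp only [bracketRatio, tripleRatio, hdet, Function.comp_apply]
    set b : Fin 6 → F := fun t => a (i.succAbove (σ t))
    have hb : ∀ t, b t ≠ 0 := fun t => Units.ne_zero _
    have hk : (b 0 * b 1 * b 2) ^ 2 * (b 3 * b 4 * b 5) ≠ 0 := by
      simp [hb]
    set A := fun s t u : Fin 6 => det3 (y (i.succAbove (σ s))) (y (i.succAbove (σ t)))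
      (y (i.succAbove (σ u)))
    refine (mul_div_mul_left (A 0 1 3 * A 1 2 4 * A 2 0 5) (A 0 1 4 * A 1 2 5 * A 2 0 3)
      hk).symm.trans ?_
    simp only [A, b]
    congr 1 <;> ring

end SevenTerm

section EightPoints

variable {F : Type} [Field F]

/-- The seven-term relation for seven points of `P^3` projected from an eighth one. -/
theorem seven_term_projection (e : Pt F 4) (x : Fin 7 → Pt F 4)
    (hx : ∀ i j k : Fin 7, i ≠ j → i ≠ k → j ≠ k →
      det4 e.rep (x i).rep (x j).rep (x k).rep ≠ 0) :
    ∑ i : Fin 7, ((-1 : ℤ) ^ (i : ℕ)) • r3From4 e (x ∘ i.succAbove) ∈ R3 F := by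
  obtain ⟨p, k, hk, hp⟩ := exists_projection e.rep (x 0).rep (x 1).rep (x 2).rep
    (hx 0 1 2 (by decide) (by decide) (by decide))
  have hmem := seven_term_mem_R3 (fun i => p (x i).rep) (fun i j l hij hil hjl h0 => by
    apply hx i j l hij hil hjl
    rw [hp, h0, mul_zero])
  convert hmem using 3 with i
  refine r3Bracket_congr (D := fun a b c : Pt F 4 => det4 e.rep a.rep b.rep c.rep) fun σ => ?_
  simp only [hp]
  rw [bracketRatio_const_mul (fun a b c : Pt F 4 => det3 (p a.rep) (p b.rep) (p c.rep)) hk]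
  rfl

/-- Projecting six points of `P^3` from a seventh one, the triple ratio is the triple ratio of the
Gale dual six points of the plane in the reverse order. -/
theorem bracketRatio_gale_dual (x : Fin 7 → Fin 4 → F) (y : Fin 7 → Fin 3 → F) (c : F)
    (hc : c ≠ 0) (hxy : ∀ π : Equiv.Perm (Fin 7),
      det4 (x (π 3)) (x (π 4)) (x (π 5)) (x (π 6)) =
        c * (Equiv.Perm.sign π : ℤ) * det3 (y (π 0)) (y (π 1)) (y (π 2)))
    (i : Fin 7) (σ : Equiv.Perm (Fin 6)) :
    bracketRatio (fun a b d => det4 (x i) (x a) (x b) (x d)) (i.succAbove ∘ σ) =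
      bracketRatio (fun a b d => det3 (y a) (y b) (y d)) (i.succAbove ∘ σ ∘ Fin.rev) := by
  obtain ⟨π, hπ⟩ := Equiv.Perm.exists_extending_pair id
    (Fin.cons i (i.succAbove ∘ σ) : Fin 7 → Fin 7) Function.injective_id
    (Fin.cons_injective_iff.2 ⟨by simp,
      Fin.succAbove_right_injective.comp σ.injective⟩)
  have hk : c * ((Equiv.Perm.sign π : ℤ) : F) ≠ 0 := by
    rcases Int.units_eq_one_or (Equiv.Perm.sign π) with h | h <;> simp [h, hc]
  have key : ∀ τ : Equiv.Perm (Fin 7), Equiv.Perm.sign τ = 1 →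
      det4 (x (π (τ 3))) (x (π (τ 4))) (x (π (τ 5))) (x (π (τ 6))) =
        c * (Equiv.Perm.sign π : ℤ) * det3 (y (π (τ 0))) (y (π (τ 1))) (y (π (τ 2))) := by
    intro τ hτ
    simpa [hτ] using hxy (π * τ)
  have k1 := key ⟨![6, 5, 3, 0, 1, 2, 4], ![3, 4, 5, 2, 6, 1, 0], by decide, by decide⟩ (by decide)
  have k2 := key ⟨![4, 6, 1, 0, 2, 3, 5], ![3, 2, 4, 5, 0, 6, 1], by decide, by decide⟩ (by decide)
  have k3 := key ⟨![5, 4, 2, 0, 3, 1, 6], ![3, 5, 2, 4, 1, 0, 6], by decide, by decide⟩ (by decide)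
  have k4 := key ⟨![4, 6, 3, 0, 1, 2, 5], ![3, 4, 5, 2, 0, 6, 1], by decide, by decide⟩ (by decide)
  have k5 := key ⟨![5, 4, 1, 0, 2, 3, 6], ![3, 2, 4, 5, 1, 0, 6], by decide, by decide⟩ (by decide)
  have k6 := key ⟨![6, 5, 2, 0, 3, 1, 4], ![3, 5, 2, 4, 6, 1, 0], by decide, by decide⟩ (by decide)
  have p0 : π 0 = i := hπ 0
  have p1 : π 1 = i.succAbove (σ 0) := hπ 1
  have p2 : π 2 = i.succAbove (σ 1) := hπ 2
  have p3 : π 3 = i.succAbove (σ 2) := hπ 3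
  have p4 : π 4 = i.succAbove (σ 3) := hπ 4
  have p5 : π 5 = i.succAbove (σ 4) := hπ 5
  have p6 : π 6 = i.succAbove (σ 5) := hπ 6
  simp only [Equiv.coe_fn_mk, Matrix.cons_val, p0, p1, p2, p3, p4, p5, p6] at k1 k2 k3 k4 k5 k6
  rw [← bracketRatio_const_mul (fun a b d => det3 (y a) (y b) (y d)) hk]
  simp only [bracketRatio, Function.comp_apply, k1, k2, k3, k4, k5, k6,
    show Fin.rev (0 : Fin 6) = 5 from rfl, show Fin.rev (1 : Fin 6) = 4 from rfl,
    show Fin.rev (2 : Fin 6) = 3 from rfl, show Fin.rev (3 : Fin 6) = 2 from rfl,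
    show Fin.rev (4 : Fin 6) = 1 from rfl, show Fin.rev (5 : Fin 6) = 0 from rfl]
  congr 1 <;> ring

/-- The dual seven-term relation: among seven points of `P^3`, each is the centre of projection of
the six others. -/
theorem seven_term_dual (x : Fin 7 → Pt F 4)
    (hx : ∀ i j k l : Fin 7, i ≠ j → i ≠ k → i ≠ l → j ≠ k → j ≠ l → k ≠ l →
      det4 (x i).rep (x j).rep (x k).rep (x l).rep ≠ 0) :
    ∑ i : Fin 7, ((-1 : ℤ) ^ (i : ℕ)) • r3From4 (x i) (x ∘ i.succAbove) ∈ R3 F := by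
  obtain ⟨y, c, hc, hxy⟩ := exists_gale_dual (fun i => (x i).rep)
    (hx 3 4 5 6 (by decide) (by decide) (by decide) (by decide) (by decide) (by decide))
  have hy : ∀ i j k : Fin 7, i ≠ j → i ≠ k → j ≠ k → det3 (y i) (y j) (y k) ≠ 0 := by
    intro i j k hij hik hjk h0
    have hinj : Function.Injective ![i, j, k] := by
      intro a b hab
      fin_cases a <;> fin_cases b <;> simp_all
    obtain ⟨π, hπ⟩ := Equiv.Perm.exists_extending_pair ![(0 : Fin 7), 1, 2] ![i, j, k]
      (by decide) hinj
    have hx' := hx (π 3) (π 4) (π 5) (π 6) (by simp) (by simp) (by simp) (by simp) (by simp)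
      (by simp)
    have h0' : π 0 = i := hπ 0
    have h1' : π 1 = j := hπ 1
    have h2' : π 2 = k := hπ 2
    rw [hxy, h0', h1', h2', h0, mul_zero] at hx'
    exact hx' rfl
  have hrev : Equiv.Perm.sign (Fin.revPerm : Equiv.Perm (Fin 6)) = -1 := by decide
  rw [← neg_mem_iff, ← Finset.sum_neg_distrib]
  convert seven_term_mem_R3 y hy using 2 with i
  have hi := r3Bracket_eq_sign_smul
    (D := fun a b c : Pt F 4 => det4 (x i).rep a.rep b.rep c.rep) (z := x ∘ i.succAbove)
    Fin.revPerm (bracketRatio_gale_dual (fun i => (x i).rep) y c hc hxy i)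
  rw [hrev, Units.val_neg, Units.val_one, neg_one_smul] at hi
  rw [← smul_neg]
  refine congrArg (fun t : QF F => ((-1 : ℤ) ^ (i : ℕ)) • t) ?_
  exact neg_eq_iff_eq_neg.2 hi

theorem a3p_class_symm (l m : Fin 4 → Pt F 4) (h : GenericPair l m) :
    clsB3 F (a3p l m) = clsB3 F (a3p m l) := by
  set v : Fin 8 → Pt F 4 := Fin.append l m
  let Φ : Fin 8 → Fin 7 → B3 F := fun e o =>
    clsB3 F (r3From4 (v e) (v ∘ e.succAbove ∘ o.succAbove))
  have hrow : ∀ e : Fin 8, ∑ o : Fin 7, ((-1 : ℤ) ^ (o : ℕ)) • Φ e o = 0 := by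
    intro e
    have hmem := seven_term_projection (v e) (v ∘ e.succAbove) fun i j k hij hik hjk =>
      h _ _ _ _ (by simp) (by simp) (by simp) (by simpa) (by simpa) (by simpa)
    have := (Submodule.Quotient.mk_eq_zero (R3 F)).2 hmem
    rw [← Submodule.mkQ_apply, map_sum] at this
    simp only [map_zsmul] at this
    exact this
  have hcol : ∀ o : Fin 8, ∑ e : Fin 7, ((-1 : ℤ) ^ (e : ℕ)) •
      Φ (o.succAbove e) (e.predAbove o) = 0 := by
    intro o
    have hmem := seven_term_dual (v ∘ o.succAbove) fun i j k t hij hik hit hjk hjt hkt =>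
      h _ _ _ _ (by simpa) (by simpa) (by simpa) (by simpa) (by simpa) (by simpa)
    have := (Submodule.Quotient.mk_eq_zero (R3 F)).2 hmem
    rw [← Submodule.mkQ_apply, map_sum] at this
    simp only [map_zsmul] at this
    rw [← this]
    refine Finset.sum_congr rfl fun e _ => ?_
    have hz : (o.succAbove e).succAbove ∘ (e.predAbove o).succAbove =
        o.succAbove ∘ e.succAbove :=
      funext fun t => Fin.succAbove_succAbove_succAbove_predAbove o e t
    simp only [Φ, hz]
    rfl
  have hlm : clsB3 F (a3p l m) = ∑ i : Fin 4, ∑ j : Fin 4, ((-1 : ℤ) ^ ((i : ℕ) + (j : ℕ))) •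
      Φ (Fin.castAdd 4 i) (Fin.natAdd 3 j) := by
    simp only [a3p, map_sum, map_zsmul, Φ]
    refine Finset.sum_congr rfl fun i _ => Finset.sum_congr rfl fun j _ => ?_
    have hli : v (Fin.castAdd 4 i) = l i := Fin.append_left l m i
    have hz : (Fin.castAdd 4 i).succAbove ∘ (Fin.natAdd 3 j : Fin 7).succAbove =
        ![Fin.castAdd 4 (i.succAbove 0), Fin.castAdd 4 (i.succAbove 1),
          Fin.castAdd 4 (i.succAbove 2), Fin.natAdd 4 (j.succAbove 0),
          Fin.natAdd 4 (j.succAbove 1), Fin.natAdd 4 (j.succAbove 2)] := by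
      clear hli
      decide +revert
    rw [hz, hli]
    refine congrArg (fun z => ((-1 : ℤ) ^ ((i : ℕ) + (j : ℕ))) • clsB3 F (r3From4 (l i) z)) ?_
    funext t
    fin_cases t
    exacts [(Fin.append_left l m _).symm, (Fin.append_left l m _).symm,
      (Fin.append_left l m _).symm, (Fin.append_right l m _).symm,
      (Fin.append_right l m _).symm, (Fin.append_right l m _).symm]
  have hml : clsB3 F (a3p m l) = -∑ i : Fin 4, ∑ j : Fin 4, ((-1 : ℤ) ^ ((i : ℕ) + (j : ℕ))) •
      Φ (Fin.natAdd 4 i) (Fin.castAdd 3 j) := by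
    have hsign : Equiv.Perm.sign (Equiv.addRight 3 : Equiv.Perm (Fin 6)) = -1 := by decide
    simp only [a3p, map_sum, map_zsmul, Φ, ← Finset.sum_neg_distrib, ← smul_neg, ← map_neg]
    refine Finset.sum_congr rfl fun i _ => Finset.sum_congr rfl fun j _ => ?_
    congr 2
    have hcomp := r3Bracket_comp
      (fun a b c : Pt F 4 => det4 (v (Fin.natAdd 4 i)).rep a.rep b.rep c.rep)
      (v ∘ (Fin.natAdd 4 i).succAbove ∘ (Fin.castAdd 3 j).succAbove) (Equiv.addRight 3)
    rw [hsign, Units.val_neg, Units.val_one, neg_one_smul] at hcomp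
    refine Eq.trans ?_ hcomp
    have hmi : v (Fin.natAdd 4 i) = m i := Fin.append_right l m i
    have hz : ((Fin.natAdd 4 i).succAbove ∘ (Fin.castAdd 3 j).succAbove) ∘
        (Equiv.addRight 3 : Equiv.Perm (Fin 6)) =
        ![Fin.natAdd 4 (i.succAbove 0), Fin.natAdd 4 (i.succAbove 1),
          Fin.natAdd 4 (i.succAbove 2), Fin.castAdd 4 (j.succAbove 0),
          Fin.castAdd 4 (j.succAbove 1), Fin.castAdd 4 (j.succAbove 2)] := by
      clear hmi hcomp
      decide +revert
    rw [hmi, Function.comp_assoc, hz]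
    refine congrArg (r3From4 (m i)) ?_
    funext t
    fin_cases t
    exacts [(Fin.append_right l m _).symm, (Fin.append_right l m _).symm,
      (Fin.append_right l m _).symm, (Fin.append_left l m _).symm,
      (Fin.append_left l m _).symm, (Fin.append_left l m _).symm]
  have r0 := hrow 0
  have r1 := hrow 1
  have r2 := hrow 2
  have r3 := hrow 3
  have c0 := hcol 0
  have c1 := hcol 1
  have c2 := hcol 2
  have c3 := hcol 3
  rw [hlm, hml]
  clear_value Φ
  clear hlm hml hrow hcol
  have e2 : ∀ hne, Fin.castPred (2 : Fin 8) hne = 2 := fun _ => rfl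
  have e3 : ∀ hne, Fin.castPred (3 : Fin 8) hne = 3 := fun _ => rfl
  simp [Fin.sum_univ_succ, Fin.succAbove, Fin.predAbove, e2, e3] at r0 r1 r2 r3 c0 c1 c2 c3
  simp [Fin.sum_univ_succ]
  linear_combination (norm := abel) -r0 + r1 - r2 + r3 - c0 + c1 - c2 + c3

theorem det4_swap_left (u v w z : Fin 4 → F) : det4 v u w z = -det4 u v w z := by
  have := Matrix.det_permute (Equiv.swap 0 1) (Matrix.of ![u, v, w, z])
  rw [Equiv.Perm.sign_swap (by decide)] at this
  have hM : (Matrix.of ![u, v, w, z]).submatrix (Equiv.swap 0 1) id =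
      Matrix.of ![v, u, w, z] := by
    ext i j
    fin_cases i <;> rfl
  rw [hM] at this
  simpa [det4, dt] using this

theorem det4_swap_right (u v w z : Fin 4 → F) : det4 u v z w = -det4 u v w z := by
  have := Matrix.det_permute (Equiv.swap 2 3) (Matrix.of ![u, v, w, z])
  rw [Equiv.Perm.sign_swap (by decide)] at this
  have hM : (Matrix.of ![u, v, w, z]).submatrix (Equiv.swap 2 3) id =
      Matrix.of ![u, v, z, w] := by
    ext i j
    fin_cases i <;> rfl
  rw [hM] at this
  simpa [det4, dt] using this

theorem crLine_swap_axis (p q a b c d : Pt F 4) : crLine q p a b c d = crLine p q a b c d := by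
  unfold crLine
  rw [det4_swap_left p.rep q.rep a.rep c.rep, det4_swap_left p.rep q.rep b.rep d.rep,
    det4_swap_left p.rep q.rep a.rep d.rep, det4_swap_left p.rep q.rep b.rep c.rep,
    neg_mul_neg, neg_mul_neg]

theorem crLine_swap_pairs (p q a b c d : Pt F 4) : crLine p q b a d c = crLine p q a b c d := by
  unfold crLine
  congr 1 <;> exact mul_comm _ _

theorem crLine_reverse (p q a b c d : Pt F 4) : crLine p q d c b a = crLine p q a b c d := by
  unfold crLine
  rw [det4_swap_right p.rep q.rep b.rep d.rep, det4_swap_right p.rep q.rep a.rep c.rep,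
    det4_swap_right p.rep q.rep a.rep d.rep, det4_swap_right p.rep q.rep b.rep c.rep,
    neg_mul_neg, neg_mul_neg]
  congr 1
  exact mul_comm _ _

theorem mu3_crLine_symm (p q : Pt F 4) (x y : Fin 3 → Pt F 4) :
    mu3 (crLine q p) y x = mu3 (crLine p q) x y := by
  unfold mu3
  rw [Finset.sum_comm]
  refine congrArg (fun t : QF F => (1 / 4 : ℚ) • t)
    (Finset.sum_congr rfl fun σ _ => Finset.sum_congr rfl fun τ _ => ?_)
  rw [mul_comm ((Equiv.Perm.sign τ : ℤˣ) : ℤ), crLine_swap_axis p q, crLine_swap_axis p q,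
    crLine_reverse, crLine_swap_pairs p q (x (σ 0)) (y (τ 0))]

theorem a3pp_symm (l m : Fin 4 → Pt F 4) : a3pp l m = a3pp m l := by
  unfold a3pp
  rw [Finset.sum_comm]
  refine Finset.sum_congr rfl fun j _ => Finset.sum_congr rfl fun i _ => ?_
  rw [add_comm, mu3_crLine_symm]

end EightPoints

/-- Lemma 3.3.  For every admissible pair of tetrahedra `(L;M)` in
generic position in `P³(F)` one has `a_3'(L;M) = a_3'(M;L)` and `a_3''(L;M) = a_3''(M;L)`
in `B_3(F) ⊗ ℚ`. -/
theorem statement8 (F : Type) [Field F] (l m : Fin 4 → Pt F 4) (h : GenericPair l m) :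
    clsB3 F (a3p l m) = clsB3 F (a3p m l) ∧ clsB3 F (a3pp l m) = clsB3 F (a3pp m l) :=
  ⟨a3p_class_symm l m h, by rw [a3pp_symm]⟩

end Gon
end
end
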